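/- There is an absolute constant K such that for every sequence f = (f_k) in H¹(ℓ_{4/3}) and every t > 0 one has t^{-1/2}·K_t(f; H¹(ℓ₁), H¹(ℓ₂)) ≤ K·‖f‖_{H¹(ℓ_{4/3})}; that is, H¹(ℓ_{4/3}) embeds into the real interpolation space (H¹(ℓ₁), H¹(ℓ₂))_{1/2,∞} with norm at most K. -/

import Mathlib

open MeasureTheory Real ENNReal NNReal

noncomputable section

instance : Fact (0 < 2 * Real.pi) := ⟨by positivity⟩

/-- The circle group `𝕋`, realized as `ℝ / 2πℤ`. -/
abbrev 𝕋 : Type := AddCircle (2 * Real.pi)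

/-- The normalized Haar measure on `𝕋`. -/
abbrev μ𝕋 : Measure 𝕋 := AddCircle.haarAddCircle

/-- The mixed norm `‖f‖_{L^p(ℓ_q)} = (∫ (∑_k |f_k|^q)^{p/q} dm)^{1/p}` of a sequence
`f = (f_k)` of functions on `𝕋`, valued in `ℝ≥0∞`. -/
def eLpLqNorm (p q : ℝ) (f : ℕ → 𝕋 → ℂ) : ℝ≥0∞ :=
  (∫⁻ t, ((∑' k, (‖f k t‖₊ : ℝ≥0∞) ^ q) ^ (1 / q)) ^ p ∂μ𝕋) ^ (1 / p)

/-- `f = (f_k)` belongs to `L^p(ℓ_q)`. -/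
def MemLpLq (p q : ℝ) (f : ℕ → 𝕋 → ℂ) : Prop :=
  (∀ k, AEStronglyMeasurable (f k) μ𝕋) ∧ eLpLqNorm p q f < ⊤

/-- `f = (f_k)` belongs to `H^p(ℓ_q)`: it belongs to `L^p(ℓ_q)` and every Fourier
coefficient `f̂_k(n)` with `n < 0` vanishes. -/
def MemHpLq (p q : ℝ) (f : ℕ → 𝕋 → ℂ) : Prop :=
  MemLpLq p q f ∧ ∀ k, ∀ n : ℤ, n < 0 → fourierCoeff (f k) n = 0

/-- The K-functional `K_t(f; X₀, X₁)` for a couple of spaces of sequences of functions given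
by membership predicates `X₀, X₁` and (quasi-)norms `N₀, N₁`:
`inf {N₀(g₀) + t N₁(g₁) : f = g₀ + g₁, g₀ ∈ X₀, g₁ ∈ X₁}`. -/
def Kfunctional (t : ℝ≥0∞) (X₀ X₁ : (ℕ → 𝕋 → ℂ) → Prop)
    (N₀ N₁ : (ℕ → 𝕋 → ℂ) → ℝ≥0∞) (f : ℕ → 𝕋 → ℂ) : ℝ≥0∞ :=
  ⨅ (g₀ : ℕ → 𝕋 → ℂ) (g₁ : ℕ → 𝕋 → ℂ) (_ : X₀ g₀) (_ : X₁ g₁) (_ : f = g₀ + g₁),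
    N₀ g₀ + t * N₁ g₁

open Submodule in
/-- The Hardy space `H²`, as the closed span in `L²` of the characters of nonnegative frequency. -/
def hardyTwo : Submodule ℂ (Lp ℂ 2 μ𝕋) :=
  (span ℂ (Set.range fun n : ℕ => fourierLp 2 (n : ℤ))).topologicalClosure

instance : CompleteSpace hardyTwo :=
  (Submodule.isClosed_topologicalClosure _).completeSpace_coe

/-- The operator sending a real `L²` function `u` to the element of `H²` with real part `u`
and real mean: it doubles the positive frequencies, preserves the mean and kills the negative
frequencies. -/
def herglotz : Lp ℂ 2 μ𝕋 →L[ℂ] Lp ℂ 2 μ𝕋 :=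
  (2 : ℂ) • hardyTwo.starProjection - (ℂ ∙ (fourierLp 2 0 : Lp ℂ 2 μ𝕋)).starProjection

theorem fourierLp_mem_hardyTwo (n : ℕ) : fourierLp 2 (n : ℤ) ∈ hardyTwo :=
  Submodule.le_topologicalClosure _ (Submodule.subset_span ⟨n, rfl⟩)

theorem herglotz_mem_hardyTwo (f : Lp ℂ 2 μ𝕋) : herglotz f ∈ hardyTwo := by
  have h0 : (ℂ ∙ (fourierLp 2 0 : Lp ℂ 2 μ𝕋)) ≤ hardyTwo := by
    rw [Submodule.span_singleton_le_iff_mem]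
    exact_mod_cast fourierLp_mem_hardyTwo 0
  exact hardyTwo.sub_mem (hardyTwo.smul_mem _ (Submodule.starProjection_apply_mem _ _))
    (h0 (Submodule.starProjection_apply_mem _ _))

theorem norm_herglotz_apply_le (f : Lp ℂ 2 μ𝕋) : ‖herglotz f‖ ≤ 3 * ‖f‖ := by
  have h1 := hardyTwo.norm_starProjection_apply_le f
  have h2 := (ℂ ∙ (fourierLp 2 0 : Lp ℂ 2 μ𝕋)).norm_starProjection_apply_le f
  calc ‖herglotz f‖ ≤ ‖(2 : ℂ) • hardyTwo.starProjection f‖ +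
        ‖(ℂ ∙ (fourierLp 2 0 : Lp ℂ 2 μ𝕋)).starProjection f‖ := norm_sub_le _ _
    _ ≤ 2 * ‖f‖ + ‖f‖ := by
        rw [norm_smul]
        gcongr
        simp
    _ = 3 * ‖f‖ := by ring

theorem herglotz_fourierLp_zero : herglotz (fourierLp 2 0) = fourierLp 2 0 := by
  have h1 : hardyTwo.starProjection (fourierLp 2 0) = fourierLp 2 0 :=
    Submodule.starProjection_eq_self_iff.2 (by exact_mod_cast fourierLp_mem_hardyTwo 0)
  have h2 : (ℂ ∙ (fourierLp 2 0 : Lp ℂ 2 μ𝕋)).starProjection (fourierLp 2 0) = fourierLp 2 0 :=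
    Submodule.starProjection_eq_self_iff.2 (Submodule.mem_span_singleton_self _)
  simp only [herglotz, sub_apply, smul_apply, h1, h2]
  module

theorem starProjection_fourierLp_zero {n : ℤ} (hn : n ≠ 0) :
    (ℂ ∙ (fourierLp 2 0 : Lp ℂ 2 μ𝕋)).starProjection (fourierLp 2 n) = 0 := by
  rw [Submodule.starProjection_singleton, orthonormal_fourier.2 hn.symm]
  simp

theorem herglotz_fourierLp_of_pos {n : ℤ} (hn : 0 < n) :
    herglotz (fourierLp 2 n) = (2 : ℂ) • fourierLp 2 n := by
  have h1 : hardyTwo.starProjection (fourierLp 2 n) = fourierLp 2 n := by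
    lift n to ℕ using hn.le
    exact Submodule.starProjection_eq_self_iff.2 (fourierLp_mem_hardyTwo n)
  simp only [herglotz, sub_apply, smul_apply, h1,
    starProjection_fourierLp_zero hn.ne', sub_zero]

theorem herglotz_fourierLp_of_neg {n : ℤ} (hn : n < 0) : herglotz (fourierLp 2 n) = 0 := by
  have h1 : hardyTwo.starProjection (fourierLp 2 n) = 0 := by
    rw [Submodule.starProjection_apply_eq_zero_iff, hardyTwo, Submodule.orthogonal_closure,
      Submodule.mem_orthogonal]
    intro v hv
    induction hv using Submodule.span_induction with
    | mem x hx =>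
      obtain ⟨m, rfl⟩ := hx
      exact orthonormal_fourier.2 (by lia)
    | zero => simp
    | add x y _ _ hx hy => rw [inner_add_left, hx, hy, add_zero]
    | smul a x _ hx => rw [inner_smul_left, hx, mul_zero]
  simp only [herglotz, sub_apply, smul_apply, h1,
    starProjection_fourierLp_zero hn.ne, sub_zero, smul_zero]

/-- Complex conjugation on `L²`. -/
def conjLp : Lp ℂ 2 μ𝕋 →L[ℝ] Lp ℂ 2 μ𝕋 :=
  (Complex.conjCLE : ℂ →L[ℝ] ℂ).compLpL 2 μ𝕋

theorem coeFn_conjLp (f : Lp ℂ 2 μ𝕋) : ∀ᵐ x ∂μ𝕋, conjLp f x = starRingEnd ℂ (f x) :=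
  (Complex.conjCLE : ℂ →L[ℝ] ℂ).coeFn_compLpL f

theorem conjLp_smul (c : ℂ) (f : Lp ℂ 2 μ𝕋) :
    conjLp (c • f) = starRingEnd ℂ c • conjLp f := by
  apply Lp.ext
  filter_upwards [coeFn_conjLp (c • f), coeFn_conjLp f, Lp.coeFn_smul c f,
    Lp.coeFn_smul (starRingEnd ℂ c) (conjLp f)] with x h1 h2 h3 h4
  rw [h1, h4, h3, Pi.smul_apply, Pi.smul_apply, h2, smul_eq_mul, smul_eq_mul, map_mul]

theorem conjLp_fourierLp (n : ℤ) : conjLp (fourierLp 2 n) = fourierLp 2 (-n) := by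
  apply Lp.ext
  filter_upwards [coeFn_conjLp (fourierLp 2 n), coeFn_fourierLp (T := 2 * π) 2 n,
    coeFn_fourierLp (T := 2 * π) 2 (-n)] with x h1 h2 h3
  rw [h1, h3, h2, fourier_neg]

theorem herglotz_add_conjLp_fourierLp (n : ℤ) :
    herglotz (fourierLp 2 n) + conjLp (herglotz (conjLp (fourierLp 2 n))) =
      (2 : ℂ) • fourierLp 2 n := by
  have conj_two : starRingEnd ℂ (2 : ℂ) = 2 := map_ofNat _ 2
  rw [conjLp_fourierLp]
  rcases lt_trichotomy n 0 with hn | rfl | hn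
  · rw [herglotz_fourierLp_of_neg hn, herglotz_fourierLp_of_pos (by lia), conjLp_smul,
      conjLp_fourierLp, neg_neg, zero_add, conj_two]
  · rw [neg_zero, herglotz_fourierLp_zero, conjLp_fourierLp, neg_zero, two_smul]
  · rw [herglotz_fourierLp_of_pos hn, herglotz_fourierLp_of_neg (by lia), map_zero, add_zero]

theorem herglotz_add_conjLp (f : Lp ℂ 2 μ𝕋) :
    herglotz f + conjLp (herglotz (conjLp f)) = (2 : ℂ) • f := by
  have hclosed : IsClosed {f : Lp ℂ 2 μ𝕋 |
      herglotz f + conjLp (herglotz (conjLp f)) = (2 : ℂ) • f} :=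
    isClosed_eq (by fun_prop) (by fun_prop)
  have hspan : f ∈ (Submodule.span ℂ
      (Set.range (fourierLp 2 : ℤ → Lp ℂ 2 μ𝕋))).topologicalClosure := by
    rw [span_fourierLp_closure_eq_top (by simp)]
    trivial
  refine closure_minimal (fun g hg => ?_) hclosed hspan
  change herglotz g + conjLp (herglotz (conjLp g)) = (2 : ℂ) • g
  induction hg using Submodule.span_induction with
  | mem x hx =>
    obtain ⟨m, rfl⟩ := hx
    exact herglotz_add_conjLp_fourierLp m
  | zero => simp
  | add x y _ _ hx hy =>
    rw [map_add, map_add, map_add, map_add, smul_add, ← hx, ← hy]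
    abel
  | smul a x _ hx =>
    rw [conjLp_smul, map_smul, map_smul, conjLp_smul, Complex.conj_conj, ← smul_add, hx,
      smul_comm]

theorem herglotz_re {u : Lp ℂ 2 μ𝕋} (hu : ∀ᵐ x ∂μ𝕋, (u x).im = 0) :
    ∀ᵐ x ∂μ𝕋, (herglotz u x).re = (u x).re := by
  have hconj : conjLp u = u := by
    apply Lp.ext
    filter_upwards [coeFn_conjLp u, hu] with x h1 h2
    rw [h1]
    exact Complex.conj_eq_iff_im.2 h2
  have key := herglotz_add_conjLp u
  rw [hconj] at key
  filter_upwards [Lp.coeFn_add (herglotz u) (conjLp (herglotz u)), coeFn_conjLp (herglotz u),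
    Lp.coeFn_smul (2 : ℂ) u] with x h1 h2 h3
  rw [key, h3, Pi.add_apply, h2, Pi.smul_apply] at h1
  have := congrArg Complex.re h1
  simp at this
  linarith

theorem lintegral_herglotz_sq_le (f : Lp ℂ 2 μ𝕋) :
    ∫⁻ x, ‖herglotz f x‖ₑ ^ 2 ∂μ𝕋 ≤ 9 * ∫⁻ x, ‖f x‖ₑ ^ 2 ∂μ𝕋 := by
  have h (g : Lp ℂ 2 μ𝕋) : ∫⁻ x, ‖g x‖ₑ ^ 2 ∂μ𝕋 = ‖g‖ₑ ^ 2 := by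
    have := eLpNorm_nnreal_pow_eq_lintegral (f := g) (μ := μ𝕋) (p := 2) (by simp)
    simp only [NNReal.coe_ofNat, ENNReal.rpow_two] at this
    rw [Lp.enorm_def, ← this]
    rfl
  rw [h, h]
  have : ‖herglotz f‖ₑ ≤ 3 * ‖f‖ₑ := by
    have := norm_herglotz_apply_le f
    simp only [enorm_eq_nnnorm]
    exact_mod_cast this
  calc _ ≤ (3 * ‖f‖ₑ) ^ 2 := by gcongr
    _ = 9 * ‖f‖ₑ ^ 2 := by
      rw [mul_pow]
      norm_num

/-- The scalar Hardy space `H¹`. -/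
def HardyOne (f : 𝕋 → ℂ) : Prop :=
  Integrable f μ𝕋 ∧ ∀ n : ℤ, n < 0 → fourierCoeff f n = 0

theorem HardyOne.congr {f g : 𝕋 → ℂ} (hf : HardyOne f) (h : f =ᵐ[μ𝕋] g) : HardyOne g :=
  ⟨hf.1.congr h, fun n hn => by rw [← fourierCoeff_congr_ae h, hf.2 n hn]⟩

theorem HardyOne.add {f g : 𝕋 → ℂ} (hf : HardyOne f) (hg : HardyOne g) :
    HardyOne (fun x => f x + g x) :=
  ⟨hf.1.add hg.1, fun n hn => by
    change fourierCoeff (f + g) n = 0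
    rw [fourierCoeff.add hf.1 hg.1, Pi.add_apply, hf.2 n hn, hg.2 n hn, add_zero]⟩

theorem HardyOne.const_mul {f : 𝕋 → ℂ} (hf : HardyOne f) (c : ℂ) :
    HardyOne (fun x => c * f x) :=
  ⟨hf.1.const_mul c, fun n hn => by rw [fourierCoeff.const_mul, hf.2 n hn, mul_zero]⟩

theorem fourierCoeff_fourier_mul (f : 𝕋 → ℂ) (m n : ℤ) :
    fourierCoeff (fun x => fourier m x * f x) n = fourierCoeff f (n - m) := by
  simp only [fourierCoeff, smul_eq_mul]
  congr 1 with x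
  rw [← mul_assoc, ← fourier_add]
  congr 3
  ring

theorem norm_fourier_apply (n : ℤ) (x : 𝕋) : ‖fourier n x‖ = 1 := by
  rw [fourier_apply]
  exact Circle.norm_coe _

theorem HardyOne.fourier_mul {f : 𝕋 → ℂ} (hf : HardyOne f) (m : ℕ) :
    HardyOne (fun x => fourier (m : ℤ) x * f x) :=
  ⟨hf.1.bdd_mul (fourier (m : ℤ)).continuous.aestronglyMeasurable
      (.of_forall fun x => (norm_fourier_apply _ x).le),
    fun n hn => by rw [fourierCoeff_fourier_mul, hf.2 _ (by lia)]⟩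

theorem HardyOne.of_tendsto {F : ℕ → 𝕋 → ℂ} {f : 𝕋 → ℂ} {g : 𝕋 → ℝ}
    (hF : ∀ j, HardyOne (F j)) (hg : Integrable g μ𝕋)
    (hbound : ∀ j, ∀ᵐ x ∂μ𝕋, ‖F j x‖ ≤ g x)
    (hlim : ∀ᵐ x ∂μ𝕋, Filter.Tendsto (fun j => F j x) Filter.atTop (nhds (f x))) :
    HardyOne f := by
  refine ⟨hg.mono' (aestronglyMeasurable_of_tendsto_ae Filter.atTop
    (fun j => (hF j).1.aestronglyMeasurable) hlim) ?_, fun n hn => ?_⟩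
  · filter_upwards [ae_all_iff.2 hbound, hlim] with x h1 h2
    exact le_of_tendsto h2.norm (.of_forall h1)
  · have hconv : Filter.Tendsto (fun j => fourierCoeff (F j) n) Filter.atTop
        (nhds (fourierCoeff f n)) := by
      refine tendsto_integral_of_dominated_convergence g
        (fun j => ((hF j).1.fourier_smul _).aestronglyMeasurable) hg (fun j => ?_) ?_
      · filter_upwards [hbound j] with x hx
        rwa [norm_smul, norm_fourier_apply, one_mul]
      · filter_upwards [hlim] with x hx
        exact hx.const_smul _
    simp only [(hF _).2 n hn] at hconv
    exact tendsto_nhds_unique hconv tendsto_const_nhds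

/-- Bounded functions whose multiplication operator preserves `H¹`. -/
structure HardyMultiplier (b : 𝕋 → ℂ) : Prop where
  aestronglyMeasurable : AEStronglyMeasurable b μ𝕋
  bounded : ∃ C : ℝ, ∀ᵐ x ∂μ𝕋, ‖b x‖ ≤ C
  mul_hardyOne : ∀ f, HardyOne f → HardyOne (fun x => b x * f x)

namespace HardyMultiplier

theorem congr {b c : 𝕋 → ℂ} (hb : HardyMultiplier b) (h : b =ᵐ[μ𝕋] c) : HardyMultiplier c := by
  obtain ⟨C, hC⟩ := hb.bounded
  refine ⟨hb.aestronglyMeasurable.congr h, ⟨C, ?_⟩, fun f hf => ?_⟩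
  · filter_upwards [hC, h] with x h1 h2
    rwa [← h2]
  · refine (hb.mul_hardyOne f hf).congr ?_
    filter_upwards [h] with x hx
    rw [hx]

theorem const (c : ℂ) : HardyMultiplier (fun _ => c) :=
  ⟨aestronglyMeasurable_const, ⟨‖c‖, .of_forall fun _ => le_rfl⟩, fun _ hf => hf.const_mul c⟩

theorem fourier (m : ℕ) : HardyMultiplier (_root_.fourier (m : ℤ)) :=
  ⟨(_root_.fourier (m : ℤ)).continuous.aestronglyMeasurable,
    ⟨1, .of_forall fun x => (norm_fourier_apply _ x).le⟩, fun _ hf => hf.fourier_mul m⟩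

theorem add {b c : 𝕋 → ℂ} (hb : HardyMultiplier b) (hc : HardyMultiplier c) :
    HardyMultiplier (fun x => b x + c x) := by
  obtain ⟨B, hB⟩ := hb.bounded
  obtain ⟨C, hC⟩ := hc.bounded
  refine ⟨hb.aestronglyMeasurable.add hc.aestronglyMeasurable, ⟨B + C, ?_⟩, fun f hf => ?_⟩
  · filter_upwards [hB, hC] with x h1 h2
    exact norm_add_le_of_le h1 h2
  · simpa only [add_mul] using (hb.mul_hardyOne f hf).add (hc.mul_hardyOne f hf)

theorem mul {b c : 𝕋 → ℂ} (hb : HardyMultiplier b) (hc : HardyMultiplier c) :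
    HardyMultiplier (fun x => b x * c x) := by
  obtain ⟨B, hB⟩ := hb.bounded
  obtain ⟨C, hC⟩ := hc.bounded
  refine ⟨hb.aestronglyMeasurable.mul hc.aestronglyMeasurable, ⟨B * C, ?_⟩, fun f hf => ?_⟩
  · filter_upwards [hB, hC] with x h1 h2
    exact norm_mul_le_of_le h1 h2
  · simpa only [mul_assoc] using hb.mul_hardyOne _ (hc.mul_hardyOne f hf)

theorem geom_sum {b : 𝕋 → ℂ} (hb : HardyMultiplier b) (N : ℕ) :
    HardyMultiplier (fun x => ∑ j ∈ Finset.range N, b x ^ j) := by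
  induction N with
  | zero => simpa using const 0
  | succ N ih => simpa only [geom_sum_succ] using (hb.mul ih).add (const 1)

theorem of_tendsto {b : ℕ → 𝕋 → ℂ} {c : 𝕋 → ℂ} {C : ℝ} (hb : ∀ j, HardyMultiplier (b j))
    (hbound : ∀ j, ∀ᵐ x ∂μ𝕋, ‖b j x‖ ≤ C)
    (hlim : ∀ᵐ x ∂μ𝕋, Filter.Tendsto (fun j => b j x) Filter.atTop (nhds (c x))) :
    HardyMultiplier c := by
  refine ⟨aestronglyMeasurable_of_tendsto_ae Filter.atTop
    (fun j => (hb j).aestronglyMeasurable) hlim, ⟨C, ?_⟩, fun f hf => ?_⟩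
  · filter_upwards [ae_all_iff.2 hbound, hlim] with x h1 h2
    exact le_of_tendsto h2.norm (.of_forall h1)
  · refine HardyOne.of_tendsto (fun j => (hb j).mul_hardyOne f hf) (hf.1.norm.const_mul C)
      (fun j => ?_) ?_
    · filter_upwards [hbound j] with x hx
      rw [norm_mul]
      gcongr
    · filter_upwards [hlim] with x hx
      exact hx.mul_const _

theorem of_mem_span {q : C(𝕋, ℂ)}
    (hq : q ∈ Submodule.span ℂ (Set.range fun n : ℕ => _root_.fourier (T := 2 * π) (n : ℤ))) :
    HardyMultiplier q := by
  induction hq using Submodule.span_induction with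
  | mem x hx =>
    obtain ⟨m, rfl⟩ := hx
    exact fourier m
  | zero => exact const 0
  | add x y _ _ hx hy => exact hx.add hy
  | smul a x _ hx => exact (const a).mul hx

theorem inv {b : 𝕋 → ℂ} (hb : HardyMultiplier b) {ε : ℝ} (hε : 0 < ε)
    (hre : ∀ᵐ x ∂μ𝕋, ε ≤ (b x).re) : HardyMultiplier (fun x => (b x)⁻¹) := by
  obtain ⟨C₀, hC₀⟩ := hb.bounded
  obtain ⟨C, hC, hC_pos⟩ : ∃ C : ℝ, (∀ᵐ x ∂μ𝕋, ‖b x‖ ≤ C) ∧ 0 < C :=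
    ⟨max C₀ 1, hC₀.mono fun x hx => hx.trans (le_max_left _ _), by positivity⟩
  set M : ℝ := C ^ 2 / ε with hM
  have hM_pos : 0 < M := by positivity
  set r : ℝ := √(1 - ε ^ 2 / C ^ 2) with hr
  have hr_lt : r < 1 := by
    rw [hr, Real.sqrt_lt' one_pos]
    have : 0 < ε ^ 2 / C ^ 2 := by positivity
    linarith
  have hcontr : ∀ᵐ x ∂μ𝕋, ‖1 + (-(M : ℂ)⁻¹) * b x‖ ≤ r := by
    filter_upwards [hC, hre] with x h1 h2
    refine Real.le_sqrt_of_sq_le ?_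
    have h3 : ‖b x‖ ^ 2 ≤ C ^ 2 := by gcongr
    rw [← Complex.normSq_eq_norm_sq, Complex.normSq_apply] at h3 ⊢
    have e1 : (1 + (-(M : ℂ)⁻¹) * b x).re = 1 - M⁻¹ * (b x).re := by
      rw [← Complex.ofReal_inv, ← Complex.ofReal_neg]
      simp
      ring
    have e2 : (1 + (-(M : ℂ)⁻¹) * b x).im = - (M⁻¹ * (b x).im) := by
      rw [← Complex.ofReal_inv, ← Complex.ofReal_neg]
      simp
    rw [e1, e2]
    have h4 : M⁻¹ * ε ≤ M⁻¹ * (b x).re := by gcongr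
    have h5 : M⁻¹ ^ 2 * ((b x).re * (b x).re + (b x).im * (b x).im) ≤ M⁻¹ ^ 2 * C ^ 2 := by
      gcongr
    have h6 : M⁻¹ ^ 2 * C ^ 2 = ε ^ 2 / C ^ 2 := by rw [hM]; field_simp
    have h7 : M⁻¹ * ε = ε ^ 2 / C ^ 2 := by rw [hM]; field_simp
    nlinarith
  have hr_nonneg : 0 ≤ r := Real.sqrt_nonneg _
  have hmult := ((const 1).add ((const (-(M : ℂ)⁻¹)).mul hb)).geom_sum
  refine of_tendsto (C := M⁻¹ * (1 - r)⁻¹) (fun N => (const (M : ℂ)⁻¹).mul (hmult N)) ?_ ?_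
  · intro N
    filter_upwards [hcontr] with x hx
    rw [norm_mul, norm_inv, Complex.norm_of_nonneg hM_pos.le]
    gcongr
    calc ‖∑ j ∈ Finset.range N, (1 + -(M : ℂ)⁻¹ * b x) ^ j‖
        ≤ ∑ j ∈ Finset.range N, r ^ j := by
          refine norm_sum_le_of_le _ fun j _ => ?_
          rw [norm_pow]
          gcongr
      _ ≤ (1 - r)⁻¹ := by
          rw [← tsum_geometric_of_lt_one hr_nonneg hr_lt]
          exact (summable_geometric_of_lt_one hr_nonneg hr_lt).sum_le_tsum _
            (fun j _ => by positivity)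
  · filter_upwards [hcontr] with x hx
    have hM0 : (M : ℂ) ≠ 0 := by exact_mod_cast hM_pos.ne'
    have := ((hasSum_geometric_of_norm_lt_one (hx.trans_lt hr_lt)).tendsto_sum_nat).const_mul
      (M : ℂ)⁻¹
    convert this using 2
    rw [show 1 - (1 + -(M : ℂ)⁻¹ * b x) = (M : ℂ)⁻¹ * b x by ring, mul_inv, inv_inv,
      inv_mul_cancel_left₀ hM0]

end HardyMultiplier

theorem exists_herglotz_toLp_eq {q : C(𝕋, ℂ)}
    (hq : q ∈ Submodule.span ℂ (Set.range (fourier (T := 2 * π)))) :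
    ∃ r ∈ Submodule.span ℂ (Set.range fun n : ℕ => fourier (T := 2 * π) (n : ℤ)),
      herglotz (ContinuousMap.toLp 2 μ𝕋 ℂ q) = ContinuousMap.toLp 2 μ𝕋 ℂ r := by
  induction hq using Submodule.span_induction with
  | mem x hx =>
    obtain ⟨n, rfl⟩ := hx
    rcases lt_trichotomy n 0 with hn | rfl | hn
    · exact ⟨0, zero_mem _, by rw [map_zero]; exact herglotz_fourierLp_of_neg hn⟩
    · exact ⟨fourier 0, Submodule.subset_span ⟨0, rfl⟩, herglotz_fourierLp_zero⟩
    · lift n to ℕ using hn.le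
      exact ⟨(2 : ℂ) • fourier (n : ℤ), Submodule.smul_mem _ _ (Submodule.subset_span ⟨n, rfl⟩),
        by rw [map_smul]; exact herglotz_fourierLp_of_pos hn⟩
  | zero => exact ⟨0, zero_mem _, by simp⟩
  | add x y _ _ hx hy =>
    obtain ⟨r, hr, hxr⟩ := hx
    obtain ⟨s, hs, hys⟩ := hy
    exact ⟨r + s, add_mem hr hs, by rw [map_add, map_add, map_add, hxr, hys]⟩
  | smul a x _ hx =>
    obtain ⟨r, hr, hxr⟩ := hx
    exact ⟨a • r, Submodule.smul_mem _ _ hr, by rw [map_smul, map_smul, map_smul, hxr]⟩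

/-- A continuous function with values in `[ε, ∞)` is a uniform limit of real trigonometric
polynomials with values in `[ε / 2, ∞)`. -/
theorem exists_trigPolynomial_near {v : C(𝕋, ℂ)} (him : ∀ x, (v x).im = 0) {ε δ : ℝ}
    (hε : 0 < ε) (hδ : 0 < δ) (hv : ∀ x, ε ≤ (v x).re) :
    ∃ q ∈ Submodule.span ℂ (Set.range (fourier (T := 2 * π))),
      (∀ x, (q x).im = 0) ∧ (∀ x, ε / 2 ≤ (q x).re) ∧ ‖v - q‖ < δ := by
  have hmem : v ∈ closure (fourierSubalgebra (T := 2 * π) : Set C(𝕋, ℂ)) := by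
    rw [← StarSubalgebra.topologicalClosure_coe, fourierSubalgebra_closure_eq_top]
    trivial
  obtain ⟨p, hp, hpv⟩ := Metric.mem_closure_iff.1 hmem (min (ε / 2) δ) (by positivity)
  have hpx (x : 𝕋) : ‖v x - p x‖ < min (ε / 2) δ := by
    rw [← dist_eq_norm]
    exact (ContinuousMap.dist_apply_le_dist x).trans_lt hpv
  have hqx (x : 𝕋) : ((2⁻¹ : ℂ) • (p + star p)) x = ((p x).re : ℂ) := by
    have : (p + star p) x = p x + starRingEnd ℂ (p x) := rfl
    rw [ContinuousMap.smul_apply, this, Complex.add_conj]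
    simp
  have hdist (x : 𝕋) : ‖v x - ((2⁻¹ : ℂ) • (p + star p)) x‖ ≤ ‖v x - p x‖ := by
    have : v x = ((v x).re : ℂ) := Complex.ext rfl (by simp [him])
    rw [hqx]
    nth_rw 1 [this]
    rw [← Complex.ofReal_sub, Complex.norm_real, Real.norm_eq_abs, ← Complex.sub_re]
    exact Complex.abs_re_le_norm _
  refine ⟨(2⁻¹ : ℂ) • (p + star p), ?_, fun x => ?_, fun x => ?_, ?_⟩
  · rw [← fourierSubalgebra_coe]
    exact Submodule.smul_mem _ _ (Submodule.add_mem _ hp (fourierSubalgebra.star_mem' hp))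
  · rw [hqx, Complex.ofReal_im]
  · rw [hqx, Complex.ofReal_re]
    have h1 := (Complex.abs_re_le_norm (v x - p x)).trans_lt ((hpx x).trans_le (min_le_left _ _))
    rw [Complex.sub_re, abs_lt] at h1
    linarith [hv x]
  · rw [ContinuousMap.norm_lt_iff _ hδ]
    exact fun x => (hdist x).trans_lt ((hpx x).trans_le (min_le_right _ _))

theorem exists_seq_trigPolynomial_tendsto {u : Lp ℂ 2 μ𝕋} (him : ∀ᵐ x ∂μ𝕋, (u x).im = 0) {ε : ℝ}
    (hε : 0 < ε) (hu : ∀ᵐ x ∂μ𝕋, ε ≤ (u x).re) :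
    ∃ q : ℕ → C(𝕋, ℂ), (∀ j, q j ∈ Submodule.span ℂ (Set.range (fourier (T := 2 * π)))) ∧
      (∀ j x, (q j x).im = 0) ∧ (∀ j x, ε / 2 ≤ (q j x).re) ∧
      Filter.Tendsto (fun j => ContinuousMap.toLp 2 μ𝕋 ℂ (q j)) Filter.atTop (nhds u) := by
  suffices h : u ∈ closure (ContinuousMap.toLp 2 μ𝕋 ℂ '' {q : C(𝕋, ℂ) |
      q ∈ Submodule.span ℂ (Set.range (fourier (T := 2 * π))) ∧
      (∀ x, (q x).im = 0) ∧ (∀ x, ε / 2 ≤ (q x).re)}) by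
    obtain ⟨s, hs, hlim⟩ := mem_closure_iff_seq_limit.1 h
    choose q hq hqs using hs
    exact ⟨q, fun j => (hq j).1, fun j => (hq j).2.1, fun j => (hq j).2.2, by simpa only [hqs]⟩
  rw [Metric.mem_closure_iff]
  intro δ hδ
  obtain ⟨v, hv⟩ := (ContinuousMap.toLp_denseRange ℂ μ𝕋 ℂ (p := 2) (by simp)).exists_dist_lt u
    (half_pos hδ)
  let w : C(𝕋, ℂ) := ⟨fun x => (max (v x).re ε : ℝ), by fun_prop⟩
  obtain ⟨q, hq, hq_im, hq_re, hwq⟩ := exists_trigPolynomial_near (v := w)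
    (fun x => Complex.ofReal_im _) hε (half_pos hδ) (fun x => le_max_right _ _)
  refine ⟨_, ⟨q, ⟨hq, hq_im, hq_re⟩, rfl⟩, ?_⟩
  have h1 : dist u (ContinuousMap.toLp 2 μ𝕋 ℂ w) ≤ dist u (ContinuousMap.toLp 2 μ𝕋 ℂ v) := by
    rw [dist_eq_norm, dist_eq_norm]
    refine Lp.norm_le_norm_of_ae_le ?_
    filter_upwards [Lp.coeFn_sub u (ContinuousMap.toLp 2 μ𝕋 ℂ w),
      Lp.coeFn_sub u (ContinuousMap.toLp 2 μ𝕋 ℂ v), ContinuousMap.coeFn_toLp (p := 2) (𝕜 := ℂ) μ𝕋 w,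
      ContinuousMap.coeFn_toLp (p := 2) (𝕜 := ℂ) μ𝕋 v, him, hu] with x e1 e2 e3 e4 e5 e6
    rw [e1, e2, Pi.sub_apply, Pi.sub_apply, e3, e4]
    have hux : u x = ((u x).re : ℂ) := Complex.ext rfl (by simp [e5])
    have hwx : w x = ((max (v x).re ε : ℝ) : ℂ) := rfl
    calc ‖u x - w x‖ = |max (u x).re ε - max (v x).re ε| := by
          rw [hwx, hux, ← Complex.ofReal_sub, Complex.norm_real, Real.norm_eq_abs,
            Complex.ofReal_re, max_eq_left e6]
      _ ≤ |(u x).re - (v x).re| := abs_max_sub_max_le_abs _ _ _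
      _ ≤ ‖u x - v x‖ := by
          rw [← Complex.sub_re]
          exact Complex.abs_re_le_norm _
  have h2 : dist (ContinuousMap.toLp 2 μ𝕋 ℂ w) (ContinuousMap.toLp 2 μ𝕋 ℂ q) < δ / 2 := by
    rw [dist_eq_norm, ← map_sub]
    refine lt_of_le_of_lt ?_ hwq
    refine (ContinuousLinearMap.le_opNorm _ _).trans ?_
    refine mul_le_of_le_one_left (norm_nonneg _) ?_
    refine (ContinuousMap.toLp_norm_le (p := 2) (𝕜 := ℂ) μ𝕋).trans ?_
    simp [measureUnivNNReal]
  linarith [dist_triangle u (ContinuousMap.toLp 2 μ𝕋 ℂ w) (ContinuousMap.toLp 2 μ𝕋 ℂ q)]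

theorem hardyMultiplier_inv_herglotz {u : Lp ℂ 2 μ𝕋} (him : ∀ᵐ x ∂μ𝕋, (u x).im = 0) {ε : ℝ}
    (hε : 0 < ε) (hu : ∀ᵐ x ∂μ𝕋, ε ≤ (u x).re) :
    HardyMultiplier (fun x => (herglotz u x)⁻¹) := by
  obtain ⟨q, hq, hq_im, hq_re, hlim⟩ := exists_seq_trigPolynomial_tendsto him hε hu
  have hlim' := (herglotz.continuous.tendsto u).comp hlim
  obtain ⟨n, -, hn⟩ := (tendstoInMeasure_of_tendsto_Lp hlim').exists_seq_tendsto_ae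
  have hre (j : ℕ) : ∀ᵐ x ∂μ𝕋, ε / 2 ≤ (herglotz (ContinuousMap.toLp 2 μ𝕋 ℂ (q j)) x).re := by
    have hcoe := ContinuousMap.coeFn_toLp (p := 2) (𝕜 := ℂ) μ𝕋 (q j)
    have him_q : ∀ᵐ x ∂μ𝕋, (ContinuousMap.toLp 2 μ𝕋 ℂ (q j) x).im = 0 := by
      filter_upwards [hcoe] with x hx
      rw [hx, hq_im]
    filter_upwards [hcoe, herglotz_re him_q] with x h1 h2
    rw [h2, h1]
    exact hq_re j x
  have hmult (j : ℕ) :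
      HardyMultiplier (fun x => (herglotz (ContinuousMap.toLp 2 μ𝕋 ℂ (q j)) x)⁻¹) := by
    refine HardyMultiplier.inv ?_ (half_pos hε) (hre j)
    obtain ⟨r, hr, hqr⟩ := exists_herglotz_toLp_eq (hq j)
    rw [hqr]
    exact (HardyMultiplier.of_mem_span hr).congr
      (ContinuousMap.coeFn_toLp (p := 2) (𝕜 := ℂ) μ𝕋 r).symm
  refine HardyMultiplier.of_tendsto (C := (ε / 2)⁻¹) (fun j => hmult (n j)) (fun j => ?_) ?_
  · filter_upwards [hre (n j)] with x hx
    rw [norm_inv]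
    gcongr
    exact hx.trans (Complex.re_le_norm _)
  · filter_upwards [hn, herglotz_re him, hu] with x h1 h2 h3
    refine h1.inv₀ fun h0 => ?_
    rw [h0, Complex.zero_re] at h2
    linarith

theorem integral_mul_eq_zero_of_mem_hardyTwo {Y : 𝕋 → ℂ} (hY : MemLp Y 2 μ𝕋)
    (h : ∀ j : ℕ, ∫ x, Y x * fourier (j : ℤ) x ∂μ𝕋 = 0) {D : Lp ℂ 2 μ𝕋} (hD : D ∈ hardyTwo) :
    ∫ x, Y x * D x ∂μ𝕋 = 0 := by
  have hYc : MemLp (fun x => starRingEnd ℂ (Y x)) 2 μ𝕋 := hY.star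
  have hinner (g : Lp ℂ 2 μ𝕋) : inner ℂ (hYc.toLp _) g = ∫ x, Y x * g x ∂μ𝕋 := by
    rw [L2.inner_def]
    refine integral_congr_ae ?_
    filter_upwards [hYc.coeFn_toLp] with x hx
    rw [hx, RCLike.inner_apply, Complex.conj_conj, mul_comm]
  rw [← hinner, ← Submodule.mem_orthogonal_singleton_iff_inner_right]
  refine Submodule.topologicalClosure_minimal _ ?_ (Submodule.isClosed_orthogonal _) hD
  rw [Submodule.span_le]
  rintro _ ⟨j, rfl⟩
  rw [SetLike.mem_coe, Submodule.mem_orthogonal_singleton_iff_inner_right, hinner, ← h j]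
  refine integral_congr_ae ?_
  filter_upwards [coeFn_fourierLp (T := 2 * π) 2 j] with x hx
  rw [hx]

/-- A bounded function in `H¹` times the square of a function in `H²` belongs to `H¹`. -/
theorem HardyOne.mul_sq {X : 𝕋 → ℂ} (hX : HardyOne X) {C : ℝ} (hC : ∀ᵐ x ∂μ𝕋, ‖X x‖ ≤ C)
    {D : Lp ℂ 2 μ𝕋} (hD : D ∈ hardyTwo) : HardyOne (fun x => X x * D x ^ 2) := by
  have hbdd (m : ℤ) : ∀ᵐ x ∂μ𝕋, ‖fourier m x * X x‖ ≤ C := by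
    filter_upwards [hC] with x hx
    rwa [norm_mul, norm_fourier_apply, one_mul]
  have hmeas (m : ℤ) : AEStronglyMeasurable (fun x => fourier m x * X x) μ𝕋 :=
    (fourier m).continuous.aestronglyMeasurable.mul hX.1.aestronglyMeasurable
  have hXm (m : ℤ) : MemLp (fun x => fourier m x * X x) 2 μ𝕋 := MemLp.of_bound (hmeas m) C (hbdd m)
  have hDsq : Integrable (fun x => D x ^ 2) μ𝕋 := by
    simp only [pow_two]
    exact (Lp.memLp D).integrable_mul (Lp.memLp D)
  refine ⟨hDsq.bdd_mul hX.1.aestronglyMeasurable hC, fun n hn => ?_⟩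
  have hzero (j i : ℕ) : ∫ x, (fourier (-n + j) x * X x) * fourier (i : ℤ) x ∂μ𝕋 = 0 := by
    rw [← hX.2 (n - j - i) (by lia), fourierCoeff]
    congr 1 with x
    rw [smul_eq_mul, mul_right_comm, ← fourier_add]
    congr 3
    ring
  have hone (j : ℕ) : ∫ x, (fourier (-n) x * X x * D x) * fourier (j : ℤ) x ∂μ𝕋 = 0 := by
    rw [← integral_mul_eq_zero_of_mem_hardyTwo (hXm (-n + j)) (hzero j) hD]
    congr 1 with x
    rw [fourier_add]
    ring
  have hXD : MemLp (fun x => fourier (-n) x * X x * D x) 2 μ𝕋 :=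
    (Lp.memLp D).of_le_mul (c := C) ((hmeas _).mul (Lp.aestronglyMeasurable D)) (by
      filter_upwards [hbdd (-n)] with x hx
      rw [norm_mul]
      gcongr)
  rw [fourierCoeff, ← integral_mul_eq_zero_of_mem_hardyTwo hXD hone hD]
  congr 1 with x
  rw [smul_eq_mul]
  ring

theorem le_norm_add_of_re {p z : ℝ} {A D : ℂ} (hA : A.re = z ^ 3) (hD : D.re = p ^ 2 * z ^ 3) :
    z ^ 3 * (1 + p ^ 2) ≤ ‖A + D‖ := by
  refine le_trans (le_of_eq ?_) (Complex.re_le_norm _)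
  rw [Complex.add_re, hA, hD]
  ring

theorem norm_mul_inv_sq_le {κ p z : ℝ} (hκ : 0 < κ) (hz : 0 < z) {a A D : ℂ}
    (ha : ‖a‖ = (κ * p * z ^ 2) ^ 3) (hA : A.re = z ^ 3) (hD : D.re = p ^ 2 * z ^ 3) :
    ‖(A + D)⁻¹ * ((A + D)⁻¹ * a)‖ ≤ κ ^ 3 := by
  have hB := le_norm_add_of_re hA hD
  have hB_pos : 0 < ‖A + D‖ := lt_of_lt_of_le (by positivity) hB
  rw [norm_mul, norm_mul, norm_inv, ha, inv_mul_le_iff₀ hB_pos, inv_mul_le_iff₀ hB_pos]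
  have hp3 : p ^ 3 ≤ (1 + p ^ 2) ^ 2 := by nlinarith [sq_nonneg (p - 1), sq_nonneg (p ^ 2 - p)]
  calc (κ * p * z ^ 2) ^ 3 = κ ^ 3 * z ^ 6 * p ^ 3 := by ring
    _ ≤ κ ^ 3 * z ^ 6 * (1 + p ^ 2) ^ 2 := by gcongr
    _ = (z ^ 3 * (1 + p ^ 2)) * ((z ^ 3 * (1 + p ^ 2)) * κ ^ 3) := by ring
    _ ≤ _ := by gcongr

theorem norm_sub_mul_inv_sq_le {κ p z : ℝ} (hκ : 0 < κ) (hz : 0 < z) {a A D : ℂ}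
    (ha : ‖a‖ = (κ * p * z ^ 2) ^ 3) (hA : A.re = z ^ 3) (hD : D.re = p ^ 2 * z ^ 3) :
    ‖a - (A + D)⁻¹ * ((A + D)⁻¹ * a) * D ^ 2‖ ≤ 3 * κ ^ 3 * p ^ 2 * ‖A‖ ^ 2 := by
  have hB := le_norm_add_of_re hA hD
  have hB_pos : 0 < ‖A + D‖ := lt_of_lt_of_le (by positivity) hB
  have hAz : z ^ 3 ≤ ‖A‖ := hA ▸ Complex.re_le_norm A
  have hne : A + D ≠ 0 := norm_pos_iff.1 hB_pos
  have key : a - (A + D)⁻¹ * ((A + D)⁻¹ * a) * D ^ 2 =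
      2 * (a * A * (A + D)⁻¹) - a * A ^ 2 * (A + D)⁻¹ ^ 2 := by
    field_simp
    ring
  have hpp : p ≤ 1 + p ^ 2 := by nlinarith [sq_nonneg (p - 1)]
  have h1 : ‖a‖ * ‖A + D‖⁻¹ ≤ κ ^ 3 * p ^ 2 * z ^ 3 := by
    rw [mul_inv_le_iff₀ hB_pos, ha]
    calc (κ * p * z ^ 2) ^ 3 = κ ^ 3 * p ^ 2 * z ^ 3 * (z ^ 3 * p) := by ring
      _ ≤ κ ^ 3 * p ^ 2 * z ^ 3 * (z ^ 3 * (1 + p ^ 2)) := by gcongr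
      _ ≤ _ := by gcongr
  have h2 : z ^ 3 * ‖A + D‖⁻¹ ≤ 1 := by
    rw [mul_inv_le_iff₀ hB_pos]
    refine le_trans ?_ (hB.trans_eq (one_mul _).symm)
    exact le_mul_of_one_le_right (by positivity) (by nlinarith)
  rw [key]
  calc ‖2 * (a * A * (A + D)⁻¹) - a * A ^ 2 * (A + D)⁻¹ ^ 2‖
      ≤ ‖2 * (a * A * (A + D)⁻¹)‖ + ‖a * A ^ 2 * (A + D)⁻¹ ^ 2‖ := norm_sub_le _ _
    _ = 2 * ((‖a‖ * ‖A + D‖⁻¹) * ‖A‖) + (‖a‖ * ‖A + D‖⁻¹) * ‖A‖ ^ 2 * ‖A + D‖⁻¹ := by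
        simp only [norm_mul, norm_pow, norm_inv, RCLike.norm_ofNat]
        ring
    _ ≤ 2 * ((κ ^ 3 * p ^ 2 * z ^ 3) * ‖A‖) +
        (κ ^ 3 * p ^ 2 * z ^ 3) * ‖A‖ ^ 2 * ‖A + D‖⁻¹ := by gcongr
    _ = 2 * ((κ ^ 3 * p ^ 2 * z ^ 3) * ‖A‖) +
        (κ ^ 3 * p ^ 2) * ‖A‖ ^ 2 * (z ^ 3 * ‖A + D‖⁻¹) := by ring
    _ ≤ 2 * ((κ ^ 3 * p ^ 2 * ‖A‖) * ‖A‖) + (κ ^ 3 * p ^ 2) * ‖A‖ ^ 2 * 1 := by gcongr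
    _ = _ := by ring

theorem eLpLqNorm_one (q : ℝ) (f : ℕ → 𝕋 → ℂ) :
    eLpLqNorm 1 q f = ∫⁻ x, (∑' k, ‖f k x‖ₑ ^ q) ^ (1 / q) ∂μ𝕋 := by
  simp only [eLpLqNorm, ENNReal.rpow_one, div_one]
  rfl

theorem HardyOne.sub {f g : 𝕋 → ℂ} (hf : HardyOne f) (hg : HardyOne g) :
    HardyOne (fun x => f x - g x) := by
  simpa [sub_eq_add_neg] using hf.add (hg.const_mul (-1))

theorem memHpLq_of_hardyOne {q : ℝ} {f : ℕ → 𝕋 → ℂ} (hf : ∀ k, HardyOne (f k))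
    (h : eLpLqNorm 1 q f < ⊤) : MemHpLq 1 q f :=
  ⟨⟨fun k => (hf k).1.aestronglyMeasurable, h⟩, fun k => (hf k).2⟩

theorem MemHpLq.hardyOne {q : ℝ} (hq : 0 < q) {f : ℕ → 𝕋 → ℂ} (hf : MemHpLq 1 q f) (k : ℕ) :
    HardyOne (f k) := by
  refine ⟨⟨hf.1.1 k, lt_of_le_of_lt ?_ hf.1.2⟩, hf.2 k⟩
  rw [eLpLqNorm_one]
  refine lintegral_mono fun x => ?_
  calc ‖f k x‖ₑ = (‖f k x‖ₑ ^ q) ^ (1 / q) := by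
        rw [← ENNReal.rpow_mul, mul_one_div_cancel hq.ne', ENNReal.rpow_one]
    _ ≤ _ := by
        gcongr
        exact ENNReal.le_tsum k

theorem exists_toLp_ofReal {d : 𝕋 → ℝ} (hd : AEMeasurable d μ𝕋)
    (hint : ∫⁻ x, ENNReal.ofReal (d x ^ 2) ∂μ𝕋 < ⊤) :
    ∃ U : Lp ℂ 2 μ𝕋, ∀ᵐ x ∂μ𝕋, U x = (d x : ℂ) := by
  have hmem : MemLp (fun x => (d x : ℂ)) 2 μ𝕋 := by
    refine ⟨(Complex.measurable_ofReal.comp_aemeasurable hd).aestronglyMeasurable, ?_⟩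
    rw [eLpNorm_lt_top_iff_lintegral_rpow_enorm_lt_top (by simp) (by simp)]
    convert hint using 3 with x
    rw [ENNReal.toReal_ofNat, ENNReal.rpow_two, ← ofReal_norm, Complex.norm_real,
      ← ENNReal.ofReal_pow (norm_nonneg _), Real.norm_eq_abs, sq_abs]
  exact ⟨hmem.toLp _, hmem.coeFn_toLp⟩

theorem lintegral_herglotz_sq_le_of_ae_eq {U : Lp ℂ 2 μ𝕋} {d : 𝕋 → ℝ}
    (hU : ∀ᵐ x ∂μ𝕋, U x = (d x : ℂ)) :
    ∫⁻ x, ‖herglotz U x‖ₑ ^ 2 ∂μ𝕋 ≤ 9 * ∫⁻ x, ENNReal.ofReal (d x ^ 2) ∂μ𝕋 := by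
  refine (lintegral_herglotz_sq_le U).trans_eq ?_
  congr 1
  refine lintegral_congr_ae ?_
  filter_upwards [hU] with x hx
  rw [hx, ← ofReal_norm, Complex.norm_real, ← ENNReal.ofReal_pow (norm_nonneg _),
    Real.norm_eq_abs, sq_abs]

theorem exists_hardy_decomposition {f : ℕ → 𝕋 → ℂ} (hf : ∀ k, HardyOne (f k)) {κ c : ℝ}
    (hκ : 0 < κ) (hc : 0 < c) {z : 𝕋 → ℝ} {p : ℕ → 𝕋 → ℝ} (hz : AEMeasurable z μ𝕋)
    (hcz : ∀ x, c ≤ z x) (hz_int : ∫⁻ x, ENNReal.ofReal (z x ^ 6) ∂μ𝕋 < ⊤)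
    (hp : ∀ k, AEMeasurable (p k) μ𝕋)
    (hfp : ∀ k x, ‖f k x‖ = (κ * p k x * z x ^ 2) ^ 3)
    (hsum : ∀ᵐ x ∂μ𝕋, ∑' k, ENNReal.ofReal (p k x ^ 4) ≤ ENNReal.ofReal (κ ^ 4)⁻¹) :
    ∃ g₀ g₁ : ℕ → 𝕋 → ℂ, (∀ k, HardyOne (g₀ k)) ∧ (∀ k, HardyOne (g₁ k)) ∧ f = g₀ + g₁ ∧
      eLpLqNorm 1 1 g₀ ≤ ENNReal.ofReal (9 * κ⁻¹) * ∫⁻ x, ENNReal.ofReal (z x ^ 6) ∂μ𝕋 ∧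
      eLpLqNorm 1 2 g₁ ≤ ENNReal.ofReal (27 * κ) * ∫⁻ x, ENNReal.ofReal (z x ^ 6) ∂μ𝕋 := by
  have hz_pos (x : 𝕋) : 0 < z x := hc.trans_le (hcz x)
  have hd_meas (k : ℕ) : AEMeasurable (fun x => p k x ^ 2 * z x ^ 3) μ𝕋 :=
    ((hp k).pow_const 2).mul (hz.pow_const 3)
  have hd_sum : ∑' k, ∫⁻ x, ENNReal.ofReal ((p k x ^ 2 * z x ^ 3) ^ 2) ∂μ𝕋 ≤
      ENNReal.ofReal (κ ^ 4)⁻¹ * ∫⁻ x, ENNReal.ofReal (z x ^ 6) ∂μ𝕋 := by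
    rw [← lintegral_tsum fun k => ((hd_meas k).pow_const 2).ennreal_ofReal,
      ← lintegral_const_mul' _ _ ENNReal.ofReal_ne_top]
    refine lintegral_mono_ae ?_
    filter_upwards [hsum] with x hx
    calc ∑' k, ENNReal.ofReal ((p k x ^ 2 * z x ^ 3) ^ 2)
        = (∑' k, ENNReal.ofReal (p k x ^ 4)) * ENNReal.ofReal (z x ^ 6) := by
          rw [← ENNReal.tsum_mul_right]
          congr 1 with k
          rw [← ENNReal.ofReal_mul (by positivity)]
          ring_nf
      _ ≤ _ := by gcongr
  have hd_int (k : ℕ) : ∫⁻ x, ENNReal.ofReal ((p k x ^ 2 * z x ^ 3) ^ 2) ∂μ𝕋 < ⊤ :=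
    ((ENNReal.le_tsum k).trans hd_sum).trans_lt (ENNReal.mul_lt_top ENNReal.ofReal_lt_top hz_int)
  obtain ⟨U, hU⟩ := exists_toLp_ofReal (hz.pow_const 3) (by simpa only [← pow_mul] using hz_int)
  choose V hV using fun k => exists_toLp_ofReal (hd_meas k) (hd_int k)
  have hU_re : ∀ᵐ x ∂μ𝕋, (herglotz U x).re = z x ^ 3 := by
    filter_upwards [hU, herglotz_re (u := U) (by
      filter_upwards [hU] with x hx; rw [hx, Complex.ofReal_im])] with x h2 h1
    rw [h1, h2, Complex.ofReal_re]
  have hV_re (k : ℕ) : ∀ᵐ x ∂μ𝕋, (herglotz (V k) x).re = p k x ^ 2 * z x ^ 3 := by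
    filter_upwards [hV k, herglotz_re (u := V k) (by
      filter_upwards [hV k] with x hx; rw [hx, Complex.ofReal_im])] with x h2 h1
    rw [h1, h2, Complex.ofReal_re]
  have hinv (k : ℕ) : HardyMultiplier (fun x => (herglotz U x + herglotz (V k) x)⁻¹) := by
    have hUV : ∀ᵐ x ∂μ𝕋, (U + V k) x = ((z x ^ 3 + p k x ^ 2 * z x ^ 3 : ℝ) : ℂ) := by
      filter_upwards [Lp.coeFn_add U (V k), hU, hV k] with x h1 h2 h3
      rw [h1, Pi.add_apply, h2, h3, Complex.ofReal_add]
    refine (hardyMultiplier_inv_herglotz (u := U + V k) (ε := c ^ 3) ?_ (by positivity) ?_).congr ?_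
    · filter_upwards [hUV] with x hx
      rw [hx, Complex.ofReal_im]
    · filter_upwards [hUV] with x hx
      rw [hx, Complex.ofReal_re]
      have h1 : c ^ 3 ≤ z x ^ 3 := by gcongr; exact hcz x
      have h2 : 0 ≤ p k x ^ 2 * z x ^ 3 := mul_nonneg (sq_nonneg _) (pow_nonneg (hz_pos x).le _)
      linarith
    · rw [map_add]
      filter_upwards [Lp.coeFn_add (herglotz U) (herglotz (V k))] with x hx
      rw [hx, Pi.add_apply]
  set X : ℕ → 𝕋 → ℂ := fun k x => (herglotz U x + herglotz (V k) x)⁻¹ *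
    ((herglotz U x + herglotz (V k) x)⁻¹ * f k x) with hX
  have hX_bdd (k : ℕ) : ∀ᵐ x ∂μ𝕋, ‖X k x‖ ≤ κ ^ 3 := by
    filter_upwards [hU_re, hV_re k] with x h1 h2
    exact norm_mul_inv_sq_le hκ (hz_pos x) (hfp k x) h1 h2
  have hX_hardy (k : ℕ) : HardyOne (X k) :=
    (hinv k).mul_hardyOne _ ((hinv k).mul_hardyOne _ (hf k))
  have hg₀ (k : ℕ) : HardyOne (fun x => X k x * herglotz (V k) x ^ 2) :=
    (hX_hardy k).mul_sq (hX_bdd k) (herglotz_mem_hardyTwo _)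
  refine ⟨fun k x => X k x * herglotz (V k) x ^ 2,
    fun k x => f k x - X k x * herglotz (V k) x ^ 2, hg₀, fun k => (hf k).sub (hg₀ k), ?_, ?_, ?_⟩
  · ext k x
    simp
  · rw [eLpLqNorm_one]
    simp only [ENNReal.rpow_one, div_one]
    calc ∫⁻ x, ∑' k, ‖X k x * herglotz (V k) x ^ 2‖ₑ ∂μ𝕋
        ≤ ∫⁻ x, ∑' k, ENNReal.ofReal (κ ^ 3) * ‖herglotz (V k) x‖ₑ ^ 2 ∂μ𝕋 := by
          refine lintegral_mono_ae ?_
          filter_upwards [ae_all_iff.2 hX_bdd] with x hx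
          refine ENNReal.tsum_le_tsum fun k => ?_
          rw [enorm_mul, enorm_pow]
          gcongr
          rw [← ofReal_norm]
          exact ENNReal.ofReal_le_ofReal (hx k)
      _ = ENNReal.ofReal (κ ^ 3) * ∑' k, ∫⁻ x, ‖herglotz (V k) x‖ₑ ^ 2 ∂μ𝕋 := by
          rw [lintegral_tsum fun k => ((Lp.aestronglyMeasurable _).enorm.pow_const 2).const_mul _,
            ← ENNReal.tsum_mul_left]
          congr 1 with k
          rw [lintegral_const_mul' _ _ ENNReal.ofReal_ne_top]
      _ ≤ ENNReal.ofReal (κ ^ 3) * (9 * (ENNReal.ofReal (κ ^ 4)⁻¹ *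
            ∫⁻ x, ENNReal.ofReal (z x ^ 6) ∂μ𝕋)) := by
          gcongr
          refine le_trans ?_ (mul_le_mul_right hd_sum 9)
          rw [← ENNReal.tsum_mul_left]
          exact ENNReal.tsum_le_tsum fun k => lintegral_herglotz_sq_le_of_ae_eq (hV k)
      _ = _ := by
          rw [← ENNReal.ofReal_ofNat 9, ← mul_assoc, ← mul_assoc,
            ← ENNReal.ofReal_mul (by positivity), ← ENNReal.ofReal_mul (by positivity)]
          congr 2
          field_simp
  · rw [eLpLqNorm_one]
    simp only [ENNReal.rpow_two]
    calc ∫⁻ x, (∑' k, ‖f k x - X k x * herglotz (V k) x ^ 2‖ₑ ^ 2) ^ (1 / 2 : ℝ) ∂μ𝕋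
        ≤ ∫⁻ x, ENNReal.ofReal (3 * κ) * ‖herglotz U x‖ₑ ^ 2 ∂μ𝕋 := by
          refine lintegral_mono_ae ?_
          filter_upwards [hU_re, ae_all_iff.2 hV_re, hsum] with x h1 h2 h3
          set a := ‖herglotz U x‖
          have hterm (k : ℕ) : ‖f k x - X k x * herglotz (V k) x ^ 2‖ₑ ^ 2 ≤
              ENNReal.ofReal ((3 * κ ^ 3 * a ^ 2) ^ 2) * ENNReal.ofReal (p k x ^ 4) := by
            rw [← ofReal_norm, ← ENNReal.ofReal_pow (norm_nonneg _),
              ← ENNReal.ofReal_mul (by positivity)]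
            refine ENNReal.ofReal_le_ofReal ?_
            calc ‖f k x - X k x * herglotz (V k) x ^ 2‖ ^ 2
                ≤ (3 * κ ^ 3 * p k x ^ 2 * a ^ 2) ^ 2 := by
                  gcongr
                  exact norm_sub_mul_inv_sq_le hκ (hz_pos x) (hfp k x) h1 (h2 k)
              _ = _ := by ring
          rw [one_div, ENNReal.rpow_inv_le_iff two_pos, ENNReal.rpow_two]
          calc ∑' k, ‖f k x - X k x * herglotz (V k) x ^ 2‖ₑ ^ 2
              ≤ ENNReal.ofReal ((3 * κ ^ 3 * a ^ 2) ^ 2) * ENNReal.ofReal (κ ^ 4)⁻¹ := by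
                refine (ENNReal.tsum_le_tsum hterm).trans ?_
                rw [ENNReal.tsum_mul_left]
                gcongr
            _ = (ENNReal.ofReal (3 * κ) * ‖herglotz U x‖ₑ ^ 2) ^ 2 := by
                rw [← ofReal_norm, ← ENNReal.ofReal_pow (norm_nonneg _),
                  ← ENNReal.ofReal_mul (by positivity), ← ENNReal.ofReal_mul (by positivity),
                  ← ENNReal.ofReal_pow (by positivity)]
                congr 1
                field_simp
                ring
      _ ≤ ENNReal.ofReal (3 * κ) * (9 * ∫⁻ x, ENNReal.ofReal (z x ^ 6) ∂μ𝕋) := by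
          rw [lintegral_const_mul' _ _ ENNReal.ofReal_ne_top]
          gcongr
          simpa only [← pow_mul] using lintegral_herglotz_sq_le_of_ae_eq hU
      _ = _ := by
          rw [← ENNReal.ofReal_ofNat 9, ← mul_assoc, ← ENNReal.ofReal_mul (by positivity)]
          congr 2
          ring

theorem Kfunctional_le {t : ℝ≥0∞} {X₀ X₁ : (ℕ → 𝕋 → ℂ) → Prop}
    {N₀ N₁ : (ℕ → 𝕋 → ℂ) → ℝ≥0∞} {f g₀ g₁ : ℕ → 𝕋 → ℂ} (h₀ : X₀ g₀) (h₁ : X₁ g₁)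
    (h : f = g₀ + g₁) : Kfunctional t X₀ X₁ N₀ N₁ f ≤ N₀ g₀ + t * N₁ g₁ :=
  iInf_le_of_le g₀ <| iInf_le_of_le g₁ <| iInf_le_of_le h₀ <| iInf_le_of_le h₁ <| iInf_le _ h

theorem exists_decomposition_eLpLqNorm_le {f : ℕ → 𝕋 → ℂ} (hf : MemHpLq 1 (4 / 3) f)
    {κ η : ℝ} (hκ : 0 < κ) (hη : 0 < η) :
    ∃ g₀ g₁ : ℕ → 𝕋 → ℂ, MemHpLq 1 1 g₀ ∧ MemHpLq 1 2 g₁ ∧ f = g₀ + g₁ ∧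
      eLpLqNorm 1 1 g₀ ≤
        ENNReal.ofReal (9 * κ⁻¹) * (eLpLqNorm 1 (4 / 3) f + ENNReal.ofReal η) ∧
      eLpLqNorm 1 2 g₁ ≤
        ENNReal.ofReal (27 * κ) * (eLpLqNorm 1 (4 / 3) f + ENNReal.ofReal η) := by
  have hf_meas (k : ℕ) : AEStronglyMeasurable (f k) μ𝕋 := hf.1.1 k
  set S : 𝕋 → ℝ≥0∞ := fun x => ∑' k, ‖f k x‖ₑ ^ (4 / 3 : ℝ) with hS
  have hS_meas : AEMeasurable S μ𝕋 := AEMeasurable.tsum fun k =>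
    (hf_meas k).enorm.pow_const _
  have hnorm : eLpLqNorm 1 (4 / 3) f = ∫⁻ x, S x ^ (3 / 4 : ℝ) ∂μ𝕋 := by
    rw [eLpLqNorm_one]
    norm_num [hS]
  have hfin : ∫⁻ x, S x ^ (3 / 4 : ℝ) ∂μ𝕋 < ⊤ := hnorm ▸ hf.1.2
  have hS_fin : ∀ᵐ x ∂μ𝕋, S x ≠ ⊤ := by
    filter_upwards [ae_lt_top' (hS_meas.pow_const _) hfin.ne] with x hx h
    rw [h, ENNReal.top_rpow_of_pos (by norm_num)] at hx
    exact hx.ne rfl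
  set z : 𝕋 → ℝ := fun x => ((S x).toReal ^ (3 / 4 : ℝ) + η) ^ (1 / 6 : ℝ) with hz
  have hz_pos (x : 𝕋) : 0 < z x := by positivity
  have hz6 (x : 𝕋) : z x ^ 6 = (S x).toReal ^ (3 / 4 : ℝ) + η := by
    rw [hz, ← Real.rpow_natCast, ← Real.rpow_mul (by positivity)]
    norm_num
  have hz8 (x : 𝕋) : (S x).toReal ≤ z x ^ 8 := by
    calc (S x).toReal = ((S x).toReal ^ (3 / 4 : ℝ)) ^ (4 / 3 : ℝ) := by
          rw [← Real.rpow_mul (by positivity)]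
          norm_num
      _ ≤ (z x ^ 6) ^ (4 / 3 : ℝ) := by
          rw [hz6]
          gcongr
          linarith
      _ = z x ^ 8 := by
          rw [← Real.rpow_natCast, ← Real.rpow_natCast, ← Real.rpow_mul (hz_pos x).le]
          norm_num
  have hz_meas : AEMeasurable z μ𝕋 :=
    ((hS_meas.ennreal_toReal.pow_const _).add_const η).pow_const _
  have hz_int : ∫⁻ x, ENNReal.ofReal (z x ^ 6) ∂μ𝕋 ≤
      eLpLqNorm 1 (4 / 3) f + ENNReal.ofReal η := by
    calc ∫⁻ x, ENNReal.ofReal (z x ^ 6) ∂μ𝕋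
        ≤ ∫⁻ x, (S x ^ (3 / 4 : ℝ) + ENNReal.ofReal η) ∂μ𝕋 := by
          refine lintegral_mono fun x => ?_
          rw [hz6, ENNReal.ofReal_add (by positivity) hη.le, ENNReal.toReal_rpow]
          gcongr
          exact ENNReal.ofReal_toReal_le
      _ = _ := by
          rw [lintegral_add_right _ measurable_const, lintegral_const, measure_univ, mul_one, hnorm]
  have hV_fin : eLpLqNorm 1 (4 / 3) f + ENNReal.ofReal η < ⊤ :=
    ENNReal.add_lt_top.2 ⟨hf.1.2, ENNReal.ofReal_lt_top⟩
  set p : ℕ → 𝕋 → ℝ := fun k x => ‖f k x‖ ^ (1 / 3 : ℝ) * (κ * z x ^ 2)⁻¹ with hp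
  have hp_meas (k : ℕ) : AEMeasurable (p k) μ𝕋 :=
    ((hf_meas k).norm.aemeasurable.pow_const _).mul ((hz_meas.pow_const 2).const_mul κ).inv
  have hfp (k : ℕ) (x : 𝕋) : ‖f k x‖ = (κ * p k x * z x ^ 2) ^ 3 := by
    have hz0 := (hz_pos x).ne'
    have : κ * p k x * z x ^ 2 = ‖f k x‖ ^ (1 / 3 : ℝ) := by
      simp only [hp]
      field_simp
    rw [this, ← Real.rpow_natCast, ← Real.rpow_mul (norm_nonneg _)]
    norm_num
  have hp4 (k : ℕ) (x : 𝕋) : ENNReal.ofReal (p k x ^ 4) =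
      ‖f k x‖ₑ ^ (4 / 3 : ℝ) * ENNReal.ofReal ((κ ^ 4)⁻¹ * (z x ^ 8)⁻¹) := by
    have : (‖f k x‖ ^ (1 / 3 : ℝ)) ^ 4 = ‖f k x‖ ^ (4 / 3 : ℝ) := by
      rw [← Real.rpow_natCast, ← Real.rpow_mul (norm_nonneg _)]
      norm_num
    rw [hp, mul_pow, this, ENNReal.ofReal_mul (by positivity),
      ← ENNReal.ofReal_rpow_of_nonneg (norm_nonneg _) (by norm_num), ofReal_norm]
    congr 2
    rw [inv_pow, ← mul_inv]
    ring
  have hsum : ∀ᵐ x ∂μ𝕋, ∑' k, ENNReal.ofReal (p k x ^ 4) ≤ ENNReal.ofReal (κ ^ 4)⁻¹ := by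
    filter_upwards [hS_fin] with x hx
    simp only [hp4]
    rw [ENNReal.tsum_mul_right]
    change S x * _ ≤ _
    rw [← ENNReal.ofReal_toReal hx, ← ENNReal.ofReal_mul ENNReal.toReal_nonneg]
    refine ENNReal.ofReal_le_ofReal ?_
    have hz_pos := hz_pos x
    calc (S x).toReal * ((κ ^ 4)⁻¹ * (z x ^ 8)⁻¹)
        ≤ z x ^ 8 * ((κ ^ 4)⁻¹ * (z x ^ 8)⁻¹) := by
          gcongr
          exact hz8 x
      _ = _ := by field_simp
  obtain ⟨g₀, g₁, hg₀, hg₁, hfg, h₀, h₁⟩ := exists_hardy_decomposition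
    (c := η ^ (1 / 6 : ℝ)) (hf.hardyOne (by norm_num)) hκ (by positivity) hz_meas
    (fun x => by
      simp only [hz]
      gcongr
      linarith [Real.rpow_nonneg (ENNReal.toReal_nonneg (a := S x)) (3 / 4)])
    (hz_int.trans_lt hV_fin) hp_meas hfp hsum
  have h₀' := h₀.trans (mul_le_mul_right hz_int _)
  have h₁' := h₁.trans (mul_le_mul_right hz_int _)
  exact ⟨g₀, g₁,
    memHpLq_of_hardyOne hg₀ (h₀'.trans_lt (ENNReal.mul_lt_top ENNReal.ofReal_lt_top hV_fin)),
    memHpLq_of_hardyOne hg₁ (h₁'.trans_lt (ENNReal.mul_lt_top ENNReal.ofReal_lt_top hV_fin)),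
    hfg, h₀', h₁'⟩

/-- **Sublemma**: `H¹(ℓ_{4/3}) ⊂ (H¹(ℓ₁), H¹(ℓ₂))_{1/2,∞}` with norm at most an absolute
constant `K`: for every `f ∈ H¹(ℓ_{4/3})` and `t > 0`,
`t^{-1/2} K_t(f; H¹(ℓ₁), H¹(ℓ₂)) ≤ K ‖f‖_{H¹(ℓ_{4/3})}`. -/
theorem H1_ell_four_thirds_subset_interpolation_space :
    ∃ K : ℝ≥0, 0 < K ∧
      ∀ f : ℕ → 𝕋 → ℂ, MemHpLq 1 (4 / 3) f →
        ∀ t : ℝ, 0 < t →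
          (ENNReal.ofReal t) ^ (-(1 / 2) : ℝ) *
              Kfunctional (ENNReal.ofReal t) (MemHpLq 1 1) (MemHpLq 1 2)
                (eLpLqNorm 1 1) (eLpLqNorm 1 2) f ≤
            K * eLpLqNorm 1 (4 / 3) f := by
  refine ⟨36, by norm_num, fun f hf t ht => ?_⟩
  have hbound (η : ℝ) (hη : 0 < η) : (ENNReal.ofReal t) ^ (-(1 / 2) : ℝ) *
      Kfunctional (ENNReal.ofReal t) (MemHpLq 1 1) (MemHpLq 1 2)
        (eLpLqNorm 1 1) (eLpLqNorm 1 2) f ≤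
      36 * (eLpLqNorm 1 (4 / 3) f + ENNReal.ofReal η) := by
    set κ := t ^ (-(1 / 2) : ℝ)
    have hκ : 0 < κ := Real.rpow_pos_of_pos ht _
    have hκt : κ * (t * κ) = 1 := by
      rw [mul_comm t, ← mul_assoc, ← Real.rpow_add ht]
      norm_num
      rw [Real.rpow_neg_one, inv_mul_cancel₀ ht.ne']
    obtain ⟨g₀, g₁, hg₀, hg₁, hfg, h₀, h₁⟩ := exists_decomposition_eLpLqNorm_le hf hκ hη
    set M := eLpLqNorm 1 (4 / 3) f + ENNReal.ofReal η
    rw [ENNReal.ofReal_rpow_of_pos ht]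
    calc ENNReal.ofReal κ * Kfunctional (ENNReal.ofReal t) (MemHpLq 1 1) (MemHpLq 1 2)
          (eLpLqNorm 1 1) (eLpLqNorm 1 2) f
        ≤ ENNReal.ofReal κ * (ENNReal.ofReal (9 * κ⁻¹) * M +
            ENNReal.ofReal t * (ENNReal.ofReal (27 * κ) * M)) := by
          gcongr
          refine (Kfunctional_le hg₀ hg₁ hfg).trans ?_
          gcongr
      _ = ENNReal.ofReal (κ * (9 * κ⁻¹ + t * (27 * κ))) * M := by
          rw [ENNReal.ofReal_mul hκ.le, ENNReal.ofReal_add (by positivity) (by positivity),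
            ENNReal.ofReal_mul ht.le]
          ring
      _ = 36 * M := by
          have : κ * (9 * κ⁻¹ + t * (27 * κ)) = 36 := by
            rw [mul_add, mul_left_comm, mul_inv_cancel₀ hκ.ne']
            linear_combination 27 * hκt
          rw [this, ENNReal.ofReal_ofNat]
  have hlim : Filter.Tendsto (fun η : ℝ => 36 * (eLpLqNorm 1 (4 / 3) f + ENNReal.ofReal η))
      (nhdsWithin 0 (Set.Ioi 0)) (nhds (36 * (eLpLqNorm 1 (4 / 3) f + ENNReal.ofReal 0))) := by
    have hcont : Continuous fun η : ℝ => 36 * (eLpLqNorm 1 (4 / 3) f + ENNReal.ofReal η) :=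
      (ENNReal.continuous_const_mul (by simp)).comp
        (continuous_const.add ENNReal.continuous_ofReal)
    exact (hcont.tendsto 0).mono_left nhdsWithin_le_nhds
  rw [ENNReal.ofReal_zero, add_zero] at hlim
  exact ge_of_tendsto hlim (eventually_nhdsWithin_of_forall hbound)
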